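/- Let p be prime and let B⁺_rig denote power series in F[[π]] (F/ℚ_p finite unramified) converging on the open unit disk, with φ : π ↦ (1+π)^p − 1 extended σ-semilinearly, and t = log(1+π). Let D be a finite free 𝒪_F-module with a σ-semilinear operator φ_D such that for some integer r ≥ 1 and s ≥ 0, (p^r φ_D)^k(D) ⊆ p^{−s}D for all k ≥ 0. If g ∈ π^{r+1}·B⁺_rig ⊗ D, then φ^k(g) → 0 as k → ∞ (coefficientwise/in the Fréchet topology), so G = Σ_{k≥0} φ^k(g) converges and satisfies (1 − φ)G = g. -/

import Mathlib

open Filter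

/-- The action of `φ = φ_ring ⊗ φ_D` on `B⁺_rig ⊗ D`, where an element of `B⁺_rig ⊗ D` is
recorded by its sequence of coefficients `g : ℕ → V` (`V = F ⊗ D`): since
`φ(Σ_m v_m π^m) = Σ_m φ_D(v_m)((1+π)^p − 1)^m`, the `k`-th coefficient of `φ(g)` is
`Σ_{m ≤ k} c_{m,k} φ_D(g_m)` with `c_{m,k} = coeff_k(((1+X)^p − 1)^m) ∈ ℤ`. -/
noncomputable def frobOnSeries {F : Type*} [NontriviallyNormedField F]
    {V : Type*} [NormedAddCommGroup V] [Module F V] {σ : F →+* F}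
    (p : ℕ) (φD : V →ₛₗ[σ] V) (g : ℕ → V) : ℕ → V := fun k =>
  ∑ m ∈ Finset.range (k + 1),
    ((((Polynomial.X + 1) ^ p - 1 : Polynomial ℤ) ^ m).coeff k) • φD (g m)

section Helpers13

open Polynomial

/-- The polynomial `φ^j(X) = (1+X)^{p^j} - 1`. -/
noncomputable def phiPoly13 (p j : ℕ) : Polynomial ℤ := (X + 1) ^ (p ^ j) - 1

lemma phiPoly13_coeff_zero (p j : ℕ) : (phiPoly13 p j).coeff 0 = 0 := by
  simp [phiPoly13, coeff_zero_eq_eval_zero]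

lemma phiPoly13_pow_coeff (p j m n : ℕ) (h : n < m) : (phiPoly13 p j ^ m).coeff n = 0 := by
  have hd : (X : Polynomial ℤ) ^ m ∣ phiPoly13 p j ^ m :=
    pow_dvd_pow_of_dvd (X_dvd_iff.2 (phiPoly13_coeff_zero p j)) m
  exact (X_pow_dvd_iff.1 hd) n h

lemma phiPoly13_comp (p j : ℕ) : (phiPoly13 p j).comp (phiPoly13 p 1) = phiPoly13 p (j + 1) := by
  simp [phiPoly13, pow_succ, ← pow_mul, mul_comm]

lemma phiPoly13_sum (p j m k : ℕ) :
    ∑ n ∈ Finset.range (k + 1), (phiPoly13 p j ^ m).coeff n * (phiPoly13 p 1 ^ n).coeff k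
      = (phiPoly13 p (j + 1) ^ m).coeff k := by
  rw [← phiPoly13_comp p j, ← pow_comp]
  generalize phiPoly13 p j ^ m = P
  rw [comp, eval₂_eq_sum_range' C (n := max P.natDegree k + 1) (by omega), finsetSum_coeff]
  simp only [coeff_C_mul]
  apply Finset.sum_subset
  · intro x hx
    simp only [Finset.mem_range] at *
    omega
  · intro x _ hx
    simp only [Finset.mem_range] at *
    rw [phiPoly13_pow_coeff _ _ _ _ (by omega), mul_zero]

lemma frob13_iterate {F : Type*} [NontriviallyNormedField F]
    {V : Type*} [NormedAddCommGroup V] [Module F V] {σ : F →+* F}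
    (p : ℕ) (φD : V →ₛₗ[σ] V) (g : ℕ → V) (j : ℕ) : ∀ k,
    (frobOnSeries p φD)^[j] g k =
      ∑ m ∈ Finset.range (k + 1), (phiPoly13 p j ^ m).coeff k • φD^[j] (g m) := by
  induction j with
  | zero =>
    intro k
    rw [Finset.sum_eq_single k]
    · simp [phiPoly13]
    · intro b _ hb
      simp [phiPoly13, coeff_X_pow, hb.symm]
    · simp
  | succ j ih =>
    intro k
    rw [Function.iterate_succ_apply']
    have e : ∀ n, ((Polynomial.X + 1) ^ p - 1 : Polynomial ℤ) ^ n = phiPoly13 p 1 ^ n := by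
      intro n; simp [phiPoly13]
    simp only [frobOnSeries, e]
    have h1 : ∀ n ∈ Finset.range (k + 1),
        (phiPoly13 p 1 ^ n).coeff k • φD ((frobOnSeries p φD)^[j] g n) =
        ∑ m ∈ Finset.range (k + 1),
          ((phiPoly13 p j ^ m).coeff n * (phiPoly13 p 1 ^ n).coeff k) • φD^[j+1] (g m) := by
      intro n hn
      simp only [Finset.mem_range] at hn
      rw [ih n, map_sum, Finset.smul_sum]
      refine Eq.trans ?_ (Finset.sum_subset (s₁ := Finset.range (n + 1)) (s₂ := Finset.range (k + 1)) ?_ ?_)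
      · apply Finset.sum_congr rfl
        intro m _
        rw [map_zsmul, smul_smul, Function.iterate_succ_apply', mul_comm]
      · intro x hx
        simp only [Finset.mem_range] at *
        omega
      · intro x _ hx
        simp only [Finset.mem_range] at *
        rw [phiPoly13_pow_coeff _ _ _ _ (by omega), zero_mul, zero_smul]
    rw [Finset.sum_congr rfl h1, Finset.sum_comm]
    apply Finset.sum_congr rfl
    intro m _
    rw [← Finset.sum_smul, phiPoly13_sum]

variable {F : Type*} [NontriviallyNormedField F] [IsUltrametricDist F]

lemma intnorm13 (n : ℤ) : ‖(n : F)‖ ≤ 1 := IsUltrametricDist.norm_intCast_le_one F n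

lemma natnorm13 (p : ℕ) [hp : Fact p.Prime] (hpF : ‖(p : F)‖ = (p : ℝ)⁻¹) (i : ℕ) (hi : i ≠ 0) :
    1 ≤ i * ‖(i : F)‖ := by
  have hp1 : (1 : ℝ) < p := by exact_mod_cast hp.out.one_lt
  obtain ⟨v, u, hu, rfl⟩ := Nat.exists_eq_pow_mul_and_not_dvd hi p hp.out.ne_one
  have hu1 : 1 ≤ ‖(u : F)‖ := by
    by_contra hlt
    push Not at hlt
    have hc : IsCoprime (p : ℤ) (u : ℤ) :=
      Nat.isCoprime_iff_coprime.2 ((Nat.Prime.coprime_iff_not_dvd hp.out).2 hu)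
    obtain ⟨a, b, hab⟩ := hc
    have h1 : (a : F) * p + b * u = 1 := by exact_mod_cast congrArg (Int.cast (R := F)) hab
    have h2 : ‖(a : F) * p + b * u‖ < 1 := by
      refine lt_of_le_of_lt (IsUltrametricDist.norm_add_le_max _ _) (max_lt ?_ ?_)
      · rw [norm_mul, hpF]
        calc _ ≤ 1 * (p : ℝ)⁻¹ := by gcongr; exact intnorm13 a
          _ < 1 := by rw [one_mul]; exact inv_lt_one_of_one_lt₀ hp1
      · rw [norm_mul]
        calc _ ≤ 1 * ‖(u : F)‖ := by gcongr; exact intnorm13 b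
          _ < 1 := by rwa [one_mul]
    rw [h1, norm_one] at h2
    exact lt_irrefl _ h2
  have hu0 : (1 : ℝ) ≤ u := by
    have : u ≠ 0 := by rintro rfl; simp at hu
    exact_mod_cast Nat.one_le_iff_ne_zero.2 this
  push_cast
  rw [norm_mul, norm_pow, hpF]
  have : (p : ℝ) ^ v * u * ((p : ℝ)⁻¹ ^ v * ‖(u : F)‖) = u * ‖(u : F)‖ := by
    rw [inv_pow]; field_simp
  rw [this]
  nlinarith

lemma gauss13_mul {ρ M N : ℝ} (hρ : 0 ≤ ρ) (hM : 0 ≤ M) (hN : 0 ≤ N) (P Q : Polynomial ℤ)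
    (hP : ∀ k, ‖(P.coeff k : F)‖ * ρ ^ k ≤ M) (hQ : ∀ k, ‖(Q.coeff k : F)‖ * ρ ^ k ≤ N) (k : ℕ) :
    ‖((P * Q).coeff k : F)‖ * ρ ^ k ≤ M * N := by
  rcases hρ.eq_or_lt with rfl | hρ
  · rcases Nat.eq_zero_or_pos k with rfl | hk
    · have h1 := hP 0
      have h2 := hQ 0
      simp only [pow_zero, mul_one, mul_coeff_zero, Int.cast_mul, norm_mul] at *
      gcongr
    · rw [zero_pow hk.ne', mul_zero]; positivity
  · rw [← le_div_iff₀ (by positivity), coeff_mul, Int.cast_sum]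
    apply IsUltrametricDist.norm_sum_le_of_forall_le_of_nonneg (by positivity)
    rintro ⟨a, b⟩ hab
    replace hab : a + b = k := Finset.HasAntidiagonal.mem_antidiagonal.1 hab
    rw [le_div_iff₀ (by positivity), ← hab, pow_add, Int.cast_mul, norm_mul]
    calc _ = (‖(P.coeff a : F)‖ * ρ ^ a) * (‖(Q.coeff b : F)‖ * ρ ^ b) := by ring
      _ ≤ _ := mul_le_mul (hP a) (hQ b) (by positivity) hM

lemma gauss13_pow {ρ M : ℝ} (hρ : 0 ≤ ρ) (hM : 0 ≤ M) (P : Polynomial ℤ)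
    (hP : ∀ k, ‖(P.coeff k : F)‖ * ρ ^ k ≤ M) (n : ℕ) : ∀ k : ℕ,
    ‖((P ^ n).coeff k : F)‖ * ρ ^ k ≤ M ^ n := by
  induction n with
  | zero =>
    intro k
    rcases Nat.eq_zero_or_pos k with rfl | hk
    · simp
    · simp [coeff_one, hk.ne']
  | succ n ih =>
    intro k
    rw [pow_succ, pow_succ]
    exact gauss13_mul hρ (by positivity) hM _ _ ih hP k

lemma phiPoly13_bound1 (p j : ℕ) {ρ : ℝ} (hρ : 0 ≤ ρ) (hρ1 : ρ < 1) (k : ℕ) :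
    ‖((phiPoly13 p j).coeff k : F)‖ * ρ ^ k ≤ ρ := by
  rcases Nat.eq_zero_or_pos k with rfl | hk
  · simpa [phiPoly13_coeff_zero] using hρ
  · calc _ ≤ 1 * ρ ^ 1 := by
          apply mul_le_mul (intnorm13 _) (pow_le_pow_of_le_one hρ hρ1.le hk) (by positivity) zero_le_one
      _ = ρ := by simp

lemma phiPoly13_bound2 (p : ℕ) [hp : Fact p.Prime] (hpF : ‖(p : F)‖ = (p : ℝ)⁻¹)
    {ρ : ℝ} (hρ : 0 ≤ ρ) (hρ1 : ρ < 1) :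
    ∃ C : ℝ, 0 ≤ C ∧ ∀ j k : ℕ, 
    ‖((phiPoly13 p j).coeff k : F)‖ * ρ ^ k ≤ C * ((p : ℝ)⁻¹) ^ j := by
  have ht : Tendsto (fun n : ℕ => (n : ℝ) * ρ ^ n) atTop (nhds 0) :=
    tendsto_self_mul_const_pow_of_lt_one hρ hρ1
  obtain ⟨C, hC⟩ := ht.bddAbove_range
  have hC' : ∀ n : ℕ, (n : ℝ) * ρ ^ n ≤ C := fun n => hC ⟨n, rfl⟩
  have hC0 : 0 ≤ C := by simpa using hC' 0
  refine ⟨C, hC0, fun j k => ?_⟩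
  rcases Nat.eq_zero_or_pos k with rfl | hk
  · rw [phiPoly13_coeff_zero]; simp; positivity
  · have hco : (phiPoly13 p j).coeff k = ((p ^ j).choose k : ℤ) := by
      simp [phiPoly13, coeff_X_add_one_pow, coeff_one, hk.ne']
    have hN := natnorm13 (F := F) p hpF k hk.ne'
    obtain ⟨i, rfl⟩ : ∃ i, k = i + 1 := ⟨k - 1, by omega⟩
    obtain ⟨q, hq⟩ : ∃ q, p ^ j = q + 1 := ⟨p ^ j - 1, by have := pow_pos hp.out.pos j; omega⟩
    have h1 : ((p ^ j).choose (i + 1) : F) * ((i + 1 : ℕ) : F) = (p : F) ^ j * (q.choose i : F) := by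
      have := Nat.add_one_mul_choose_eq q i
      rw [← hq] at this
      have h := congrArg (Nat.cast (R := F)) this.symm
      push_cast at h ⊢
      exact h
    have h2 : ‖((p ^ j).choose (i + 1) : F)‖ * ‖((i + 1 : ℕ) : F)‖ ≤ ((p : ℝ)⁻¹) ^ j := by
      rw [← norm_mul, h1, norm_mul, norm_pow, hpF]
      have := intnorm13 (F := F) (q.choose i)
      rw [Int.cast_natCast] at this
      exact mul_le_of_le_one_right (by positivity) this
    rw [hco, Int.cast_natCast]
    generalize ‖((p ^ j).choose (i + 1) : F)‖ = x at *
    have hx : 0 ≤ x ∨ x < 0 := le_or_gt 0 x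
    rcases hx with hx | hx
    · calc x * ρ ^ (i + 1) = x * 1 * ρ ^ (i + 1) := by ring
        _ ≤ x * (((i + 1 : ℕ) : ℝ) * ‖((i + 1 : ℕ) : F)‖) * ρ ^ (i + 1) := by gcongr
        _ = (((i + 1 : ℕ) : ℝ) * ρ ^ (i + 1)) * (x * ‖((i + 1 : ℕ) : F)‖) := by ring
        _ ≤ C * (p : ℝ)⁻¹ ^ j := by
          calc _ ≤ (((i + 1 : ℕ) : ℝ) * ρ ^ (i + 1)) * ((p : ℝ)⁻¹ ^ j) := by gcongr
            _ ≤ _ := by gcongr; exact hC' _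
    · calc x * ρ ^ (i + 1) ≤ 0 := mul_nonpos_of_nonpos_of_nonneg hx.le (by positivity)
        _ ≤ _ := by positivity

lemma phiD13_bound (p : ℕ) [hp : Fact p.Prime] (hpF : ‖(p : F)‖ = (p : ℝ)⁻¹)
    (σ : F →+* F) (V : Type*) [NormedAddCommGroup V] [NormedSpace F V]
    (φD : V →ₛₗ[σ] V) (D : Set V)
    (hDball : ∀ x : V, ‖x‖ ≤ 1 → x ∈ D)
    (hDbdd : ∃ C : ℝ, ∀ x ∈ D, ‖x‖ ≤ C) (r s : ℕ)
    (hstab : ∀ k : ℕ, ∀ x ∈ D, (p : F) ^ s • ((fun y => (p : F) ^ r • φD y)^[k] x) ∈ D) :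
    ∃ K : ℝ, 0 ≤ K ∧ ∀ (k : ℕ) (x : V), ‖φD^[k] x‖ ≤ K * ((p : ℝ) ^ r) ^ k * ‖x‖ := by
  have hp0 : (0 : ℝ) < p := by exact_mod_cast hp.out.pos
  have hp1 : (1 : ℝ) < p := by exact_mod_cast hp.out.one_lt
  obtain ⟨C, hC⟩ := hDbdd
  have hC0 : 0 ≤ C := by simpa using hC 0 (hDball 0 (by simp))
  have hz : ∀ (n : ℤ) (y : V), φD ((p : F) ^ n • y) = (p : F) ^ n • φD y := by
    intro n y; rw [map_smulₛₗ, map_zpow₀, map_natCast]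
  have hzk : ∀ (k : ℕ) (n : ℤ) (y : V), φD^[k] ((p : F) ^ n • y) = (p : F) ^ n • φD^[k] y := by
    intro k n y
    induction k with
    | zero => rfl
    | succ k ih => rw [Function.iterate_succ_apply', ih, hz, Function.iterate_succ_apply']
  have hit : ∀ (k : ℕ) (y : V), (fun y => (p : F) ^ r • φD y)^[k] y
      = ((p : F) ^ r) ^ k • φD^[k] y := by
    intro k y
    induction k with
    | zero => simp
    | succ k ih =>
      rw [Function.iterate_succ_apply', ih, Function.iterate_succ_apply']
      simp only [map_smulₛₗ, map_pow, map_natCast, smul_smul]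
      rw [pow_succ' _ k]
  have hunit : ∀ (k : ℕ) (x : V), ‖x‖ ≤ 1 → ‖φD^[k] x‖ ≤ C * p ^ s * ((p : ℝ) ^ r) ^ k := by
    intro k x hx
    have := hC _ (hstab k x (hDball x hx))
    rw [hit, norm_smul, norm_smul, norm_pow, norm_pow, norm_pow, hpF, inv_pow, inv_pow, inv_pow,
      inv_mul_le_iff₀ (by positivity), inv_mul_le_iff₀ (by positivity)] at this
    calc _ ≤ _ := this
      _ = _ := by ring
  refine ⟨C * p ^ s * p, by positivity, fun k x => ?_⟩
  rcases eq_or_ne x 0 with rfl | hx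
  · have : φD^[k] 0 = 0 := by
      induction k with
      | zero => rfl
      | succ k ih => rw [Function.iterate_succ_apply', ih, map_zero]
    simp [this]
  · obtain ⟨n, hn1, hn2⟩ := exists_mem_Ico_zpow (norm_pos_iff.2 hx) hp1
    have h := hunit k ((p : F) ^ (n + 1) • x) (by
      rw [norm_smul, norm_zpow, hpF, inv_zpow, inv_mul_le_iff₀ (by positivity), mul_one]
      exact hn2.le)
    rw [hzk, norm_smul, norm_zpow, hpF, inv_zpow, inv_mul_le_iff₀ (by positivity),
      zpow_add_one₀ hp0.ne'] at h
    calc _ ≤ _ := h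
      _ ≤ ‖x‖ * p * (C * p ^ s * ((p : ℝ) ^ r) ^ k) := by gcongr
      _ = _ := by ring

lemma frob13_bound (p : ℕ) [hp : Fact p.Prime] (hpF : ‖(p : F)‖ = (p : ℝ)⁻¹)
    (σ : F →+* F) (V : Type*) [NormedAddCommGroup V] [NormedSpace F V] [IsUltrametricDist V]
    (φD : V →ₛₗ[σ] V) (r : ℕ) (K : ℝ) (hK : 0 ≤ K)
    (hφ : ∀ (k : ℕ) (x : V), ‖φD^[k] x‖ ≤ K * ((p : ℝ) ^ r) ^ k * ‖x‖)
    (g : ℕ → V) (hord : ∀ m : ℕ, m ≤ r → g m = 0)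
    (hconv : ∀ ρ : ℝ, 0 ≤ ρ → ρ < 1 →
      Tendsto (fun m : ℕ => ‖g m‖ * ρ ^ m) atTop (nhds 0))
    (ρ : ℝ) (hρ : 0 < ρ) (hρ1 : ρ < 1) :
    ∃ M : ℝ, 0 ≤ M ∧ ∀ j k : ℕ,
      ‖(frobOnSeries p φD)^[j] g k‖ * ρ ^ k ≤ M * ((p : ℝ)⁻¹) ^ j := by
  have hp0 : (0 : ℝ) < p := by exact_mod_cast hp.out.pos
  obtain ⟨C, hC0, hC⟩ := phiPoly13_bound2 (F := F) p hpF hρ.le hρ1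
  obtain ⟨B, hB⟩ := (hconv ρ hρ.le hρ1).bddAbove_range
  have hB' : ∀ n : ℕ, ‖g n‖ * ρ ^ n ≤ B := fun n => hB ⟨n, rfl⟩
  have hB0 : 0 ≤ B := le_trans (by positivity) (hB' 0)
  refine ⟨C ^ (r + 1) * K * (B / ρ ^ (r + 1)), by positivity, fun j k => ?_⟩
  rw [frob13_iterate, ← le_div_iff₀ (by positivity)]
  apply IsUltrametricDist.norm_sum_le_of_forall_le_of_nonneg (by positivity)
  intro m _
  rw [le_div_iff₀ (by positivity), ← Int.cast_smul_eq_zsmul F, norm_smul]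
  rcases le_or_gt m r with hm | hm
  · have h0 := hφ j (g m)
    rw [hord m hm, norm_zero, mul_zero] at h0
    rw [hord m hm, le_antisymm h0 (norm_nonneg _), mul_zero, zero_mul]
    positivity
  · obtain ⟨l, rfl⟩ : ∃ l, m = (r + 1) + l := ⟨m - (r + 1), by omega⟩
    have h1 : ‖((phiPoly13 p j ^ (r + 1 + l)).coeff k : F)‖ * ρ ^ k
        ≤ (C * ((p : ℝ)⁻¹) ^ j) ^ (r + 1) * ρ ^ l := by
      rw [pow_add]
      exact gauss13_mul hρ.le (by positivity) (by positivity) _ _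
        (gauss13_pow hρ.le (by positivity) _ (hC j) _)
        (gauss13_pow hρ.le hρ.le _ (phiPoly13_bound1 p j hρ.le hρ1) _) k
    have h2 := hφ j (g (r + 1 + l))
    have h3 : ρ ^ l * ‖g (r + 1 + l)‖ ≤ B / ρ ^ (r + 1) := by
      rw [le_div_iff₀ (by positivity)]
      calc _ = _ := by ring
        _ ≤ _ := hB' (r + 1 + l)
    calc _ = (‖((phiPoly13 p j ^ (r + 1 + l)).coeff k : F)‖ * ρ ^ k) * ‖φD^[j] (g (r + 1 + l))‖ := by
          ring
      _ ≤ ((C * ((p : ℝ)⁻¹) ^ j) ^ (r + 1) * ρ ^ l) *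
            (K * ((p : ℝ) ^ r) ^ j * ‖g (r + 1 + l)‖) :=
          mul_le_mul h1 h2 (norm_nonneg _) (by positivity)
      _ = C ^ (r + 1) * K * (ρ ^ l * ‖g (r + 1 + l)‖) *
            ((((p : ℝ)⁻¹) ^ j) ^ (r + 1) * ((p : ℝ) ^ r) ^ j) := by ring
      _ = C ^ (r + 1) * K * (ρ ^ l * ‖g (r + 1 + l)‖) * ((p : ℝ)⁻¹) ^ j := by
          congr 1
          rw [inv_pow, inv_pow, pow_succ, mul_inv, ← pow_mul, ← pow_mul, mul_comm r j]
          field_simp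
      _ ≤ _ := by gcongr

end Helpers13

/-- Let `B⁺_rig` be the ring of power series over `F` (a finite
unramified extension of `ℚ_p`, with Frobenius `σ`) converging on the open unit disk,
with `φ : π ↦ (1+π)^p − 1` extended `σ`-semilinearly.  Let `D` be a finite free
`𝒪_F`-lattice (here: a bounded lattice `D` in the normed space `V = F ⊗ D`, containing
the unit ball) with a `σ`-semilinear operator `φ_D` such that for some `r ≥ 1`, `s ≥ 0`,
`(p^r φ_D)^k(D) ⊆ p^{−s}D` for all `k ≥ 0`.  If `g ∈ π^{r+1}·B⁺_rig ⊗ D` (coefficients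
`g_m` vanish for `m ≤ r` and `‖g_m‖ρ^m → 0` for each `ρ < 1`), then `φ^k(g) → 0`
coefficientwise as `k → ∞`, so `G = Σ_{k≥0} φ^k(g)` converges (coefficientwise, to an
element of `B⁺_rig ⊗ D`) and satisfies `(1 − φ)G = g`. -/
theorem stmt13 (p : ℕ) [Fact p.Prime]
    (F : Type*) [NontriviallyNormedField F] [IsUltrametricDist F]
    (hpF : ‖(p : F)‖ = (p : ℝ)⁻¹)
    (σ : F →+* F) (hσ : ∀ x : F, ‖σ x‖ = ‖x‖)
    (V : Type*) [NormedAddCommGroup V] [NormedSpace F V] [CompleteSpace V]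
    [IsUltrametricDist V]
    (φD : V →ₛₗ[σ] V)
    (D : Set V)
    (hDball : ∀ x : V, ‖x‖ ≤ 1 → x ∈ D)
    (hDbdd : ∃ C : ℝ, ∀ x ∈ D, ‖x‖ ≤ C)
    (r s : ℕ) (hr : 1 ≤ r)
    (hstab : ∀ k : ℕ, ∀ x ∈ D, (p : F) ^ s • ((fun y => (p : F) ^ r • φD y)^[k] x) ∈ D)
    (g : ℕ → V)
    (hord : ∀ m : ℕ, m ≤ r → g m = 0)
    (hconv : ∀ ρ : ℝ, 0 ≤ ρ → ρ < 1 →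
      Tendsto (fun m : ℕ => ‖g m‖ * ρ ^ m) atTop (nhds 0)) :
    (∀ k : ℕ, Tendsto (fun j : ℕ => (frobOnSeries p φD)^[j] g k) atTop (nhds 0)) ∧
    ∃ G : ℕ → V,
      (∀ k : ℕ, HasSum (fun j : ℕ => (frobOnSeries p φD)^[j] g k) (G k)) ∧
      (∀ ρ : ℝ, 0 ≤ ρ → ρ < 1 →
        Tendsto (fun m : ℕ => ‖G m‖ * ρ ^ m) atTop (nhds 0)) ∧
      (∀ k : ℕ, G k - frobOnSeries p φD G k = g k) := by
  have hp0 : (0 : ℝ) < p := by exact_mod_cast (Fact.out : p.Prime).pos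
  have hp1 : (1 : ℝ) < p := by exact_mod_cast (Fact.out : p.Prime).one_lt
  obtain ⟨K, hK, hφ⟩ := phiD13_bound p hpF σ V φD D hDball hDbdd r s hstab
  have hb := frob13_bound p hpF σ V φD r K hK hφ g hord hconv
  have hgeo : Summable (fun j : ℕ => ((p : ℝ)⁻¹) ^ j) :=
    summable_geometric_of_lt_one (by positivity) (inv_lt_one_of_one_lt₀ hp1)
  have hsum : ∀ k : ℕ, Summable (fun j : ℕ => (frobOnSeries p φD)^[j] g k) := by
    intro k
    obtain ⟨M, hM0, hM⟩ := hb (1 / 2) (by norm_num) (by norm_num)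
    refine Summable.of_norm_bounded (g := fun j : ℕ => (M / (1 / 2) ^ k) * ((p : ℝ)⁻¹) ^ j)
      (hgeo.mul_left _) (fun j => ?_)
    have := hM j k
    rw [← le_div_iff₀ (by positivity)] at this
    calc _ ≤ _ := this
      _ = _ := by ring
  have hcont : Continuous φD := by
    have hlip : ∀ x : V, ‖φD.toAddMonoidHom x‖ ≤ (K * (p : ℝ) ^ r) * ‖x‖ := by
      intro x
      simpa using hφ 1 x
    exact AddMonoidHomClass.continuous_of_bound φD.toAddMonoidHom _ hlip
  refine ⟨fun k => (hsum k).tendsto_atTop_zero,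
    fun k => ∑' j : ℕ, (frobOnSeries p φD)^[j] g k, fun k => (hsum k).hasSum, ?_, ?_⟩
  · intro ρ hρ hρ1
    obtain ⟨ρ', h1, h2⟩ := exists_between hρ1
    have hρ'0 : 0 < ρ' := lt_of_le_of_lt hρ h1
    obtain ⟨M, hM0, hM⟩ := hb ρ' hρ'0 h2
    have hG : ∀ k : ℕ, ‖∑' j : ℕ, (frobOnSeries p φD)^[j] g k‖
        ≤ (M * ∑' j : ℕ, ((p : ℝ)⁻¹) ^ j) / ρ' ^ k := by
      intro k
      have := tsum_of_norm_bounded (f := fun j : ℕ => (frobOnSeries p φD)^[j] g k)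
        (hgeo.hasSum.mul_left (M / ρ' ^ k)) (fun j => by
          have := hM j k
          rw [← le_div_iff₀ (by positivity)] at this
          calc _ ≤ _ := this
            _ = _ := by ring)
      calc _ ≤ _ := this
        _ = _ := by ring
    have hq : Tendsto (fun m : ℕ => (M * ∑' j : ℕ, ((p : ℝ)⁻¹) ^ j) * (ρ / ρ') ^ m)
        atTop (nhds 0) := by
      simpa using (tendsto_pow_atTop_nhds_zero_of_lt_one (r := ρ / ρ') (by positivity)
        ((div_lt_one hρ'0).2 h1)).const_mul (M * ∑' j : ℕ, ((p : ℝ)⁻¹) ^ j)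
    refine squeeze_zero (fun m => by positivity) (fun m => ?_) hq
    calc _ ≤ (M * ∑' j : ℕ, ((p : ℝ)⁻¹) ^ j) / ρ' ^ m * ρ ^ m := by
          gcongr; exact hG m
      _ = _ := by rw [div_pow]; ring
  · intro k
    have h1 : HasSum (fun j : ℕ => (frobOnSeries p φD)^[j + 1] g k)
        (frobOnSeries p φD (fun k => ∑' j : ℕ, (frobOnSeries p φD)^[j] g k) k) := by
      simp only [Function.iterate_succ_apply']
      unfold frobOnSeries
      apply hasSum_sum
      intro m _
      have h2 := (hsum m).hasSum.map φD.toAddMonoidHom hcont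
      exact h2.const_smul _
    have h3 := (hsum k).tsum_eq_zero_add
    rw [h1.tsum_eq] at h3
    simp only [Function.iterate_zero, id] at h3
    rw [sub_eq_iff_eq_add]
    exact h3
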